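/- arXiv:math-ph/0405058 — 4 statements merged into one kernel-verified Lean document; each statement's English description precedes it below -/
import Mathlib

section
/- Suppose the index type W of wedges is nonempty, c : W → W satisfies c(c(w)) = w for all w, and the net satisfies wedge duality: R(c(w)) equals the commutant R(w)′ for every w ∈ W. Let M be the von Neumann algebra generated by all the algebras R(w), w ∈ W (i.e., the double commutant of the union ⋃_w R(w)). Then the commutant M′ is contained in M; consequently M′ equals the center M ∩ M′ of M, and in particular M′ is abelian. -/
/-- Suppose the index type `W` of wedges is nonempty, `c : W → W` satisfies
`c (c w) = w`, and the net satisfies wedge duality: `R (c w)` equals the commutant `R w ′`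
for every `w`.  Let `M` be the von Neumann algebra generated by all the algebras `R w`
(the double commutant of the union).  Then the commutant `M′` is contained in `M`;
consequently `M′` equals the center `M ∩ M′` of `M`, and in particular `M′` is abelian. -/
theorem stmt0 {H : Type*} [NormedAddCommGroup H] [InnerProductSpace ℂ H] [CompleteSpace H]
    {W : Type*} [Nonempty W] (R : W → VonNeumannAlgebra H) (c : W → W)
    (hc : ∀ w, c (c w) = w)
    (hdual : ∀ w, (R (c w) : Set (H →L[ℂ] H)) = Set.centralizer (R w))
    (M : Set (H →L[ℂ] H))
    (hM : M = Set.centralizer (Set.centralizer (⋃ w, (R w : Set (H →L[ℂ] H))))) :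
    Set.centralizer M ⊆ M ∧
      Set.centralizer M = M ∩ Set.centralizer M ∧
      ∀ x ∈ Set.centralizer M, ∀ y ∈ Set.centralizer M, x * y = y * x := by
  have hle : ∀ w, (R w : Set (H →L[ℂ] H)) ⊆ M := fun w =>
    hM ▸ (Set.subset_iUnion (fun w => (R w : Set (H →L[ℂ] H))) w).trans
      Set.subset_centralizer_centralizer
  have hsub : Set.centralizer M ⊆ M := by
    obtain ⟨w⟩ := ‹Nonempty W›
    exact (Set.centralizer_subset (hle w)).trans (hdual w ▸ hle (c w))
  exact ⟨hsub, (Set.inter_eq_right.2 hsub).symm, fun x hx y hy => hy x (hsub hx)⟩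
end

section
/- Assume there exists an element (n₀, h₀) ∈ G with h₀ ≠ 1 and f(n₀, h₀) = 1. Then f(1, h) = 1 for every h ∈ H; consequently f(n, h) = f(n, 1) for all (n, h) ∈ G, f(φ(h)(n), 1) = f(n, 1) for all h ∈ H and n ∈ N, and the range of f is an abelian subgroup of K (it coincides with the image of N under f). -/
open SemidirectProduct in
/-- If the kernel of `f` surjects onto the acting group, then every value of `f` is attained
on the normal factor. -/
theorem SemidirectProduct.exists_inl_eq_of_map_ker_eq_top {N H K : Type*} [Group N] [Group H]
    [Group K] {φ : H →* MulAut N} (f : N ⋊[φ] H →* K)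
    (hf : f.ker.map (rightHom : N ⋊[φ] H →* H) = ⊤) (x : N ⋊[φ] H) :
    ∃ n : N, f (inl n) = f x := by
  obtain ⟨y, hy, hyx⟩ : x.right ∈ f.ker.map (rightHom : N ⋊[φ] H →* H) := hf ▸ Subgroup.mem_top _
  have hxy : x * y⁻¹ ∈ (inl : N →* N ⋊[φ] H).range := by
    rw [range_inl_eq_ker_rightHom, MonoidHom.mem_ker, map_mul, map_inv, hyx]
    exact mul_inv_cancel x.right
  obtain ⟨n, hn⟩ := hxy
  exact ⟨n, by rw [hn, map_mul, map_inv, (MonoidHom.mem_ker.mp hy), inv_one, mul_one]⟩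

/-- A homomorphism with commuting values on a nonabelian simple group is trivial. -/
theorem MonoidHom.eq_one_of_commute_of_isSimpleGroup {H K : Type*} [Group H] [IsSimpleGroup H]
    [Group K] (hH : ¬ ∀ a b : H, a * b = b * a) (g : H →* K)
    (hg : ∀ a b, g a * g b = g b * g a) : g = 1 := by
  rcases g.normal_ker.eq_bot_or_eq_top with h | h
  · refine absurd (fun a b => (g.ker_eq_bot_iff.mp h) ?_) hH
    rw [map_mul, map_mul, hg]
  · exact MonoidHom.ker_eq_top_iff.mp h


/-- Let `N` be an abelian group, `Hg` a nonabelian simple group,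
`φ : Hg →* Aut N`, `G = N ⋊[φ] Hg`, and `f : G →* K` a group homomorphism.  If there is
`(n₀, h₀) ∈ G` with `h₀ ≠ 1` and `f (n₀, h₀) = 1`, then `f (1, h) = 1` for every `h`;
consequently `f (n, h) = f (n, 1)` for all `(n, h)`, `f (φ h n, 1) = f (n, 1)` for all `h, n`,
and the range of `f` coincides with the image of `N` under `f` and is abelian. -/
theorem stmt2 {N Hg K : Type*} [CommGroup N] [Group Hg] [IsSimpleGroup Hg]
    (hnonab : ¬ ∀ a b : Hg, a * b = b * a)
    [Group K] (φ : Hg →* MulAut N) (f : N ⋊[φ] Hg →* K)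
    (n₀ : N) (h₀ : Hg) (hh₀ : h₀ ≠ 1) (hf : f ⟨n₀, h₀⟩ = 1) :
    (∀ h : Hg, f ⟨1, h⟩ = 1) ∧
    (∀ (n : N) (h : Hg), f ⟨n, h⟩ = f ⟨n, 1⟩) ∧
    (∀ (h : Hg) (n : N), f ⟨φ h n, 1⟩ = f ⟨n, 1⟩) ∧
    (f.range = (f.comp (SemidirectProduct.inl (φ := φ))).range ∧
      ∀ x ∈ f.range, ∀ y ∈ f.range, x * y = y * x) := by
  have hnormal : (f.ker.map (SemidirectProduct.rightHom : N ⋊[φ] Hg →* Hg)).Normal :=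
    f.normal_ker.map _ SemidirectProduct.rightHom_surjective
  have htop : f.ker.map (SemidirectProduct.rightHom : N ⋊[φ] Hg →* Hg) = ⊤ := by
    refine hnormal.eq_bot_or_eq_top.resolve_left fun hbot => hh₀ ?_
    rw [← Subgroup.mem_bot, ← hbot]
    exact ⟨⟨n₀, h₀⟩, hf, rfl⟩
  have hinl := SemidirectProduct.exists_inl_eq_of_map_ker_eq_top f htop
  have hcomm : ∀ x y, f x * f y = f y * f x := by
    intro x y
    obtain ⟨m, hm⟩ := hinl x
    obtain ⟨n, hn⟩ := hinl y
    rw [← hm, ← hn, ← map_mul, ← map_mul, ← map_mul, ← map_mul, mul_comm]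
  have hone : ∀ h : Hg, f (SemidirectProduct.inr h) = 1 := DFunLike.congr_fun <|
    MonoidHom.eq_one_of_commute_of_isSimpleGroup hnonab (f.comp SemidirectProduct.inr)
      fun a b => hcomm _ _
  refine ⟨hone, fun n h => ?_, fun h n => ?_, le_antisymm ?_ ?_, ?_⟩
  · rw [SemidirectProduct.mk_eq_inl_mul_inr, map_mul, hone, mul_one]
    rfl
  · change f (SemidirectProduct.inl (φ h n)) = f (SemidirectProduct.inl n)
    rw [SemidirectProduct.inl_aut, map_mul, map_mul, hone, hone, one_mul, mul_one]
  · rintro _ ⟨x, rfl⟩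
    exact hinl x
  · rintro _ ⟨n, rfl⟩
    exact ⟨SemidirectProduct.inl n, rfl⟩
  · rintro _ ⟨x, rfl⟩ _ ⟨y, rfl⟩
    exact hcomm x y
end

section
/- Assume there exists an element (n₀, h₀) ∈ G with h₀ ≠ 1 and f(n₀, h₀) = 1, and assume in addition that N is generated as a group by the set { φ(h)(n) · n⁻¹ : h ∈ H, n ∈ N }. Then f is the trivial homomorphism: f(g) = 1 for every g ∈ G. -/
/-- If `f` kills some element with nontrivial `H`-component and `H` is simple, then the kernel
of `f` surjects onto `H`. -/
theorem SemidirectProduct.exists_map_mk_eq_one {N H K : Type*} [Group N] [Group H]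
    [IsSimpleGroup H] [Group K] {φ : H →* MulAut N} (f : N ⋊[φ] H →* K)
    {n₀ : N} {h₀ : H} (hh₀ : h₀ ≠ 1) (hf : f ⟨n₀, h₀⟩ = 1) (h : H) :
    ∃ n : N, f ⟨n, h⟩ = 1 := by
  have hnormal : (f.ker.map (SemidirectProduct.rightHom : N ⋊[φ] H →* H)).Normal :=
    f.normal_ker.map _ SemidirectProduct.rightHom_surjective
  have htop : f.ker.map (SemidirectProduct.rightHom : N ⋊[φ] H →* H) = ⊤ := by
    refine hnormal.eq_bot_or_eq_top.resolve_left fun hbot => hh₀ ?_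
    rw [← Subgroup.mem_bot, ← hbot]
    exact ⟨⟨n₀, h₀⟩, hf, rfl⟩
  obtain ⟨⟨n, _⟩, hn, rfl⟩ : h ∈ f.ker.map (SemidirectProduct.rightHom : N ⋊[φ] H →* H) :=
    htop ▸ Subgroup.mem_top h
  exact ⟨n, hn⟩

/-- If `N` is abelian and `f` kills an element with `H`-component `h`, then `f` identifies
`n` and `φ h n`. -/
theorem SemidirectProduct.map_inl_aut_eq {N H K : Type*} [CommGroup N] [Group H] [Group K]
    {φ : H →* MulAut N} (f : N ⋊[φ] H →* K) {m : N} {h : H} (hf : f ⟨m, h⟩ = 1) (n : N) :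
    f (SemidirectProduct.inl (φ h n)) = f (SemidirectProduct.inl n) := by
  have hcomm : (SemidirectProduct.inl (φ h n) : N ⋊[φ] H) * ⟨m, h⟩ =
      ⟨m, h⟩ * SemidirectProduct.inl n := by
    ext <;> simp [mul_comm]
  simpa only [map_mul, hf, mul_one, one_mul] using congrArg f hcomm

/-- In the setting of Statement 2, assume in addition that `N` is generated
by the set `{ φ h n * n⁻¹ : h ∈ Hg, n ∈ N }`.  Then `f` is trivial: `f g = 1` for all `g`. -/
theorem stmt3 {N Hg K : Type*} [CommGroup N] [Group Hg] [IsSimpleGroup Hg]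
    (hnonab : ¬ ∀ a b : Hg, a * b = b * a)
    [Group K] (φ : Hg →* MulAut N) (f : N ⋊[φ] Hg →* K)
    (n₀ : N) (h₀ : Hg) (hh₀ : h₀ ≠ 1) (hf : f ⟨n₀, h₀⟩ = 1)
    (hgen : Subgroup.closure {x : N | ∃ (h : Hg) (n : N), x = φ h n * n⁻¹} = ⊤) :
    ∀ g : N ⋊[φ] Hg, f g = 1 := by
  have hinl : f.comp SemidirectProduct.inl = 1 := by
    refine MonoidHom.eq_of_eqOn_dense hgen ?_
    rintro _ ⟨h, n, rfl⟩
    obtain ⟨m, hm⟩ := SemidirectProduct.exists_map_mk_eq_one f hh₀ hf h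
    simp only [MonoidHom.comp_apply, map_mul, map_inv, MonoidHom.one_apply,
      SemidirectProduct.map_inl_aut_eq f hm, mul_inv_cancel]
  have hinl_apply (n : N) : f (SemidirectProduct.inl n) = 1 := DFunLike.congr_fun hinl n
  rintro ⟨n, h⟩
  obtain ⟨m, hm⟩ := SemidirectProduct.exists_map_mk_eq_one f hh₀ hf h
  rw [SemidirectProduct.mk_eq_inl_mul_inr, map_mul, hinl_apply, one_mul] at hm ⊢
  exact hm
end

section
/- If the norm closure of the set {AΩ : A ∈ Y} equals the norm closure of the set {AΩ : A ∈ Z}, then Y = Z. -/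
namespace VonNeumannAlgebra

variable {H : Type*} [NormedAddCommGroup H] [InnerProductSpace ℂ H] [CompleteSpace H]

/-- The orbit `{C Ω : C ∈ S}` of a vector under a von Neumann algebra, as a subspace. -/
noncomputable def orbitSubmodule (S : VonNeumannAlgebra H) (Ω : H) : Submodule ℂ H :=
  (Subalgebra.toSubmodule S.toStarSubalgebra.toSubalgebra).map
    (ContinuousLinearMap.apply ℂ H Ω : (H →L[ℂ] H) →ₗ[ℂ] H)

theorem mem_orbitSubmodule {S : VonNeumannAlgebra H} {Ω x : H} :
    x ∈ S.orbitSubmodule Ω ↔ ∃ C ∈ S, C Ω = x :=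
  Iff.rfl

/-- A separating vector for a von Neumann algebra is cyclic for its commutant. -/
theorem topologicalClosure_orbitSubmodule_commutant {Z : VonNeumannAlgebra H} {Ω : H}
    (hsep : ∀ A ∈ Z, A Ω = 0 → A = 0) :
    (Z.commutant.orbitSubmodule Ω).topologicalClosure = ⊤ := by
  set K := (Z.commutant.orbitSubmodule Ω).topologicalClosure with hK
  have hΩ : Ω ∈ K := Submodule.le_topologicalClosure _
    (mem_orbitSubmodule.2 ⟨1, one_mem Z.commutant, rfl⟩)
  have : CompleteSpace K := (Submodule.isClosed_topologicalClosure _).completeSpace_coe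
  have hP : K.starProjection ∈ Z := by
    rw [IsStarProjection.mem_iff isStarProjection_starProjection]
    intro y hy
    rw [Submodule.range_starProjection]
    intro x hx
    refine map_mem_closure y.continuous hx ?_
    rintro _ ⟨C, hC, rfl⟩
    exact ⟨y * C, mul_mem (S := VonNeumannAlgebra H) hy hC, rfl⟩
  have h := hsep (1 - K.starProjection) (sub_mem (one_mem Z) hP) (by
    simp [Submodule.starProjection_eq_self_iff.2 hΩ])
  rw [eq_top_iff]
  intro x _
  rw [← Submodule.starProjection_eq_self_iff, ← sub_eq_zero.1 h]
  rfl

/-- The elements of an abelian von Neumann algebra are normal, so an element and its adjoint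
have equal norms at each vector. -/
theorem norm_adjoint_apply {Z : VonNeumannAlgebra H} (hZ : ∀ a ∈ Z, ∀ b ∈ Z, a * b = b * a)
    {A : H →L[ℂ] H} (hA : A ∈ Z) (x : H) : ‖(star A) x‖ = ‖A x‖ := by
  have : IsStarNormal A := ⟨hZ _ (star_mem hA) _ hA⟩
  exact (ContinuousLinearMap.isStarNormal_iff_norm_eq_adjoint.1 this x).symm

/-- An element of an abelian von Neumann algebra `Z` lies in a subalgebra `Y` as soon as its value
at a separating vector is approximated by values of elements of `Y`. -/
theorem mem_of_apply_mem_closure {Z Y : VonNeumannAlgebra H} {Ω : H}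
    (hZ : ∀ a ∈ Z, ∀ b ∈ Z, a * b = b * a) (hsep : ∀ A ∈ Z, A Ω = 0 → A = 0)
    (hYZ : ∀ A ∈ Y, A ∈ Z) {A : H →L[ℂ] H} (hA : A ∈ Z)
    (hcl : A Ω ∈ closure ((fun B : H →L[ℂ] H => B Ω) '' (Y : Set (H →L[ℂ] H)))) : A ∈ Y := by
  obtain ⟨u, hu, hlim⟩ := mem_closure_iff_seq_limit.1 hcl
  choose B hB hBu using hu
  have hdense : Dense (Z.commutant.orbitSubmodule Ω : Set H) :=
    Submodule.dense_iff_topologicalClosure_eq_top.2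
      (topologicalClosure_orbitSubmodule_commutant hsep)
  have hconv : ∀ x ∈ Z.commutant.orbitSubmodule Ω,
      Filter.Tendsto (fun n => B n x) Filter.atTop (nhds (A x)) := by
    intro x hx
    obtain ⟨C, hC, rfl⟩ := mem_orbitSubmodule.1 hx
    have hcomm : ∀ D ∈ Z, D (C Ω) = C (D Ω) := fun D hD =>
      congr($(mem_commutant_iff.1 hC D hD) Ω)
    simp only [hcomm A hA, fun n => hcomm (B n) (hYZ _ (hB n))]
    refine (C.continuous.tendsto _).comp ?_
    exact hlim.congr fun n => (hBu n).symm
  have hconv_star : ∀ x ∈ Z.commutant.orbitSubmodule Ω,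
      Filter.Tendsto (fun n => star (B n) x) Filter.atTop (nhds (star A x)) := by
    intro x hx
    have h := hconv x hx
    rw [tendsto_iff_norm_sub_tendsto_zero] at h ⊢
    refine h.congr fun n => ?_
    have := norm_adjoint_apply hZ (sub_mem (hYZ _ (hB n)) hA) x
    simpa using this.symm
  rw [← commutant_commutant Y, mem_commutant_iff]
  intro T hT
  have hTB (n : ℕ) (x : H) : T (B n x) = B n (T x) :=
    congr($((mem_commutant_iff.1 hT (B n) (hB n)).symm) x)
  have key : ∀ x ∈ Z.commutant.orbitSubmodule Ω, T (A x) = A (T x) := by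
    intro x hx
    refine hdense.eq_of_inner_left ℂ fun y hy => ?_
    have h₁ : Filter.Tendsto (fun n => inner ℂ (T (B n x)) y) Filter.atTop
        (nhds (inner ℂ (T (A x)) y)) :=
      ((T.continuous.tendsto _).comp (hconv x hx)).inner tendsto_const_nhds
    have h₂ : Filter.Tendsto (fun n => inner ℂ (T x) (star (B n) y)) Filter.atTop
        (nhds (inner ℂ (T x) (star A y))) :=
      tendsto_const_nhds.inner (hconv_star y hy)
    simp only [ContinuousLinearMap.star_eq_adjoint, ContinuousLinearMap.adjoint_inner_right,
      ← hTB] at h₂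
    exact tendsto_nhds_unique h₁ h₂
  ext x
  exact congr_fun (Continuous.ext_on hdense (T * A).continuous (A * T).continuous key) x

end VonNeumannAlgebra


/-- Let `Z` be an abelian von Neumann algebra on `H`, `Ω` a separating vector
for `Z`, and `Y ⊆ Z` a von Neumann subalgebra.  If the norm closure of `{A Ω : A ∈ Y}` equals
the norm closure of `{A Ω : A ∈ Z}`, then `Y = Z`. -/
theorem stmt4 {H : Type*} [NormedAddCommGroup H] [InnerProductSpace ℂ H] [CompleteSpace H]
    (Z Y : VonNeumannAlgebra H)
    (hZab : ∀ a ∈ Z, ∀ b ∈ Z, a * b = b * a)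
    (Ω : H)
    (hsep : ∀ A ∈ Z, A Ω = 0 → A = 0)
    (hYZ : (Y : Set (H →L[ℂ] H)) ⊆ (Z : Set (H →L[ℂ] H)))
    (hcl : closure ((fun A : H →L[ℂ] H => A Ω) '' (Y : Set (H →L[ℂ] H))) =
           closure ((fun A : H →L[ℂ] H => A Ω) '' (Z : Set (H →L[ℂ] H)))) :
    Y = Z := by
  refine SetLike.coe_injective (hYZ.antisymm fun A hA => ?_)
  refine VonNeumannAlgebra.mem_of_apply_mem_closure hZab hsep hYZ hA ?_
  rw [hcl]
  exact subset_closure ⟨A, hA, rfl⟩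
end
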